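/- Suppose z₂ : R≥0 → R^3 and η : R≥0 → R^3 are differentiable, and at every time the inequality (z₂ᵀ + ηᵀ M) ν ≤ -ηᵀ w holds where η̇ = M(u_n + ν) + w' with ηᵀ(M u_n + w') = ηᵀ w. If additionally ż₂ᵀ z₂ ≤ z₂ᵀ ν - c‖z₂‖² for some c ≥ 0, then t ↦ ‖z₂(t)‖² + ‖η(t)‖² is non-increasing. -/

import Mathlib

open Matrix

/-- Abstract Lyapunov decrease argument of Lemma 1: if
`η̇ = M(u_n + ν) + w'` with `ηᵀ(M u_n + w') = ηᵀ w`, the inequality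
`(z₂ᵀ + ηᵀM)ν ≤ -ηᵀw` holds, and `ż₂ᵀz₂ ≤ z₂ᵀν - c‖z₂‖²` for some `c ≥ 0`,
then `t ↦ ‖z₂(t)‖² + ‖η(t)‖²` is non-increasing. -/
theorem abstract_lyapunov_decrease
    (M : ℝ → Matrix (Fin 3) (Fin 3) ℝ)
    (w w' un ν : ℝ → Fin 3 → ℝ)
    (z₂ z₂' η : ℝ → Fin 3 → ℝ) (c : ℝ) (hc : 0 ≤ c)
    (hz₂ : ∀ t, HasDerivAt z₂ (z₂' t) t)
    (hη : ∀ t, HasDerivAt η ((M t) *ᵥ (un t + ν t) + w' t) t)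
    (hw : ∀ t, η t ⬝ᵥ ((M t) *ᵥ un t + w' t) = η t ⬝ᵥ w t)
    (hν : ∀ t, z₂ t ⬝ᵥ ν t + η t ⬝ᵥ ((M t) *ᵥ ν t) ≤ -(η t ⬝ᵥ w t))
    (hdec : ∀ t, z₂' t ⬝ᵥ z₂ t ≤ z₂ t ⬝ᵥ ν t - c * (z₂ t ⬝ᵥ z₂ t)) :
    Antitone (fun t => z₂ t ⬝ᵥ z₂ t + η t ⬝ᵥ η t) := by
  have key : ∀ (f : ℝ → Fin 3 → ℝ) (f' : Fin 3 → ℝ) (t : ℝ), HasDerivAt f f' t →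
      HasDerivAt (fun s => f s ⬝ᵥ f s) (2 * (f t ⬝ᵥ f')) t := by
    intro f f' t hf
    have h := fun i => (hasDerivAt_pi.1 hf) i
    have h2 := HasDerivAt.fun_sum (u := Finset.univ) (fun i _ => (h i).mul (h i))
    refine h2.congr_deriv ?_
    simp only [dotProduct, Finset.mul_sum]
    exact Finset.sum_congr rfl (fun i _ => by ring)
  have hd := fun t => (key _ _ t (hz₂ t)).add (key _ _ t (hη t))
  refine antitone_of_hasDerivAt_nonpos hd (fun t => ?_)
  have h1 := hw t
  have h2 := hν t
  have h3 := hdec t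
  have h4 : 0 ≤ c * (z₂ t ⬝ᵥ z₂ t) :=
    mul_nonneg hc (Finset.sum_nonneg fun i _ => mul_self_nonneg _)
  rw [dotProduct_comm (z₂' t)] at h3
  simp only [mulVec_add, dotProduct_add] at h1 ⊢
  show _ ≤ (0 : ℝ)
  linarith
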